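/- Let C be a symmetrizable Cartan matrix of Dynkin type with Coxeter transformation c and with β_k = s₁⋯s_{k−1}(α_k). For each i let pᵢ ≥ 1 be minimal with c^{−pᵢ}(βᵢ) ∉ ℕⁿ. Then the vectors c^{−r}(βᵢ) for 1 ≤ i ≤ n and 0 ≤ r ≤ pᵢ−1 are pairwise distinct, and their set equals the set Δ⁺(C) of positive roots of C. -/

import Mathlib

/-- The quadratic form associated to a symmetrizable generalized Cartan matrix. -/
def cartanQuadForm (n : ℕ) (C : Matrix (Fin n) (Fin n) ℤ) (c : Fin n → ℤ)
    (x : Fin n → ℤ) : ℤ :=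
  (∑ i, c i * x i ^ 2) -
    ∑ p ∈ Finset.univ.filter (fun p : Fin n × Fin n => p.1 < p.2),
      c p.1 * |C p.1 p.2| * x p.1 * x p.2

/-- The simple reflection `sᵢ : ℤⁿ → ℤⁿ`. -/
def simpleRefl (n : ℕ) (C : Matrix (Fin n) (Fin n) ℤ) (i : Fin n) (x : Fin n → ℤ) :
    Fin n → ℤ :=
  fun l => x l - (if l = i then ∑ j, C i j * x j else 0)

/-- The standard basis vector `αᵢ` of `ℤⁿ`. -/
def simpleRoot (n : ℕ) (i : Fin n) : Fin n → ℤ := fun l => if l = i then 1 else 0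

/-- The inverse Coxeter transformation `c⁻¹ = s₁⋯sₙ` (`sₙ` applied first). -/
def coxeterMinus (n : ℕ) (C : Matrix (Fin n) (Fin n) ℤ) (x : Fin n → ℤ) : Fin n → ℤ :=
  (List.finRange n).foldr (fun i y => simpleRefl n C i y) x

/-- `βₖ = s₁ s₂ ⋯ s_{k−1}(αₖ)` (`s_{k-1}` applied first). -/
def betaRoot (n : ℕ) (C : Matrix (Fin n) (Fin n) ℤ) (kk : Fin n) : Fin n → ℤ :=
  ((List.finRange n).take kk).foldr (fun i y => simpleRefl n C i y) (simpleRoot n kk)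

/-- The Weyl group as the set of finite products of the simple reflections. -/
def weylSet (n : ℕ) (C : Matrix (Fin n) (Fin n) ℤ) : Set ((Fin n → ℤ) → (Fin n → ℤ)) :=
  {f | ∃ l : List (Fin n), f = fun x => l.foldl (fun y i => simpleRefl n C i y) x}

/-- The root system `Δ(C) = ∪ᵢ W(C)(αᵢ)`. -/
def rootSet (n : ℕ) (C : Matrix (Fin n) (Fin n) ℤ) : Set (Fin n → ℤ) :=
  {y | ∃ f ∈ weylSet n C, ∃ i : Fin n, y = f (simpleRoot n i)}

namespace CoxAux

variable {n : ℕ} {C : Matrix (Fin n) (Fin n) ℤ} {c : Fin n → ℤ}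

/-- pairing with the coroot -/
def hh (C : Matrix (Fin n) (Fin n) ℤ) (i : Fin n) (x : Fin n → ℤ) : ℤ := ∑ j, C i j * x j

/-- the symmetric bilinear form -/
noncomputable def BB (C : Matrix (Fin n) (Fin n) ℤ) (c : Fin n → ℤ) :
    LinearMap.BilinForm ℤ (Fin n → ℤ) :=
  Matrix.toBilin' (Matrix.of fun i j => c i * C i j)

lemma BB_apply (x y : Fin n → ℤ) :
    BB C c x y = ∑ i, ∑ j, x i * (c i * C i j) * y j := by
  simp [BB, Matrix.toBilin'_apply]

lemma BB_symm (hsym : ∀ i j, c i * C i j = c j * C j i) (x y : Fin n → ℤ) :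
    BB C c x y = BB C c y x := by
  rw [BB_apply, BB_apply, Finset.sum_comm]
  refine Finset.sum_congr rfl fun i _ => Finset.sum_congr rfl fun j _ => ?_
  rw [hsym j i]; ring

lemma BB_left (i : Fin n) (y : Fin n → ℤ) :
    BB C c (simpleRoot n i) y = c i * hh C i y := by
  rw [BB_apply, Finset.sum_eq_single i]
  · simp [simpleRoot, hh, Finset.mul_sum, mul_assoc]
  · intro b _ hb; simp [simpleRoot, hb]
  · simp

lemma hh_simple (i j : Fin n) : hh C i (simpleRoot n j) = C i j := by
  simp [hh, simpleRoot]

lemma refl_eq (i : Fin n) (x : Fin n → ℤ) :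
    simpleRefl n C i x = x - hh C i x • simpleRoot n i := by
  funext l
  by_cases h : l = i <;> simp [simpleRefl, simpleRoot, hh, h]

lemma refl_ne {i l : Fin n} (x : Fin n → ℤ) (h : l ≠ i) : simpleRefl n C i x l = x l := by
  simp [simpleRefl, h]

lemma hh_sub (i : Fin n) (x y : Fin n → ℤ) : hh C i (x - y) = hh C i x - hh C i y := by
  simp [hh, mul_sub]

lemma hh_add (i : Fin n) (x y : Fin n → ℤ) : hh C i (x + y) = hh C i x + hh C i y := by
  simp [hh, mul_add, Finset.sum_add_distrib]

lemma hh_smul (i : Fin n) (m : ℤ) (x : Fin n → ℤ) : hh C i (m • x) = m * hh C i x := by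
  simp only [hh, Finset.mul_sum, Pi.smul_apply, smul_eq_mul]
  exact Finset.sum_congr rfl fun j _ => by ring

lemma refl_add (i : Fin n) (x y : Fin n → ℤ) :
    simpleRefl n C i (x + y) = simpleRefl n C i x + simpleRefl n C i y := by
  rw [refl_eq, refl_eq, refl_eq, hh_add]; module

lemma refl_smul (i : Fin n) (m : ℤ) (x : Fin n → ℤ) :
    simpleRefl n C i (m • x) = m • simpleRefl n C i x := by
  rw [refl_eq, refl_eq, hh_smul]; module

lemma refl_refl (hdiag : ∀ i, C i i = 2) (i : Fin n) (x : Fin n → ℤ) :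
    simpleRefl n C i (simpleRefl n C i x) = x := by
  rw [refl_eq, refl_eq, hh_sub, hh_smul, hh_simple, hdiag]; module

lemma refl_BB (hdiag : ∀ i, C i i = 2) (hsym : ∀ i j, c i * C i j = c j * C j i)
    (i : Fin n) (x : Fin n → ℤ) :
    BB C c (simpleRefl n C i x) (simpleRefl n C i x) = BB C c x x := by
  rw [refl_eq]
  simp only [map_sub, map_smul, LinearMap.sub_apply, LinearMap.smul_apply, smul_eq_mul]
  rw [BB_symm hsym x (simpleRoot n i), BB_left, BB_left, hh_simple, hdiag]; ring

/-- apply reflections, last of the list first -/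
abbrev FR (C : Matrix (Fin n) (Fin n) ℤ) (l : List (Fin n)) (x : Fin n → ℤ) : Fin n → ℤ :=
  l.foldr (fun i y => simpleRefl n C i y) x

/-- apply reflections, head of the list first -/
abbrev FL (C : Matrix (Fin n) (Fin n) ℤ) (l : List (Fin n)) (x : Fin n → ℤ) : Fin n → ℤ :=
  l.foldl (fun y i => simpleRefl n C i y) x

lemma FL_FR (hdiag : ∀ i, C i i = 2) (l : List (Fin n)) (x : Fin n → ℤ) :
    FL C l (FR C l x) = x := by
  induction l with
  | nil => rfl
  | cons a t ih => simp only [FL, FR, List.foldl_cons, List.foldr_cons] at *; rw [refl_refl hdiag, ih]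

lemma FR_FL (hdiag : ∀ i, C i i = 2) (l : List (Fin n)) (x : Fin n → ℤ) :
    FR C l (FL C l x) = x := by
  induction l generalizing x with
  | nil => rfl
  | cons a t ih =>
    simp only [FL, FR, List.foldl_cons, List.foldr_cons] at *; rw [ih, refl_refl hdiag]

lemma FL_add (l : List (Fin n)) (x y : Fin n → ℤ) : FL C l (x + y) = FL C l x + FL C l y := by
  induction l generalizing x y with
  | nil => rfl
  | cons a t ih => simp only [FL, List.foldl_cons] at *; rw [refl_add, ih]

lemma FL_smul (l : List (Fin n)) (m : ℤ) (x : Fin n → ℤ) : FL C l (m • x) = m • FL C l x := by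
  induction l generalizing x with
  | nil => rfl
  | cons a t ih => simp only [FL, List.foldl_cons] at *; rw [refl_smul, ih]

lemma FR_smul (l : List (Fin n)) (m : ℤ) (x : Fin n → ℤ) : FR C l (m • x) = m • FR C l x := by
  induction l with
  | nil => rfl
  | cons a t ih => simp only [FR, List.foldr_cons] at *; rw [ih, refl_smul]

lemma FL_apply {l : List (Fin n)} {k : Fin n} (hk : k ∉ l) (x : Fin n → ℤ) :
    FL C l x k = x k := by
  induction l generalizing x with
  | nil => rfl
  | cons a t ih =>
    simp only [List.mem_cons, not_or] at hk
    simp only [FL, List.foldl_cons] at *; rw [ih hk.2, refl_ne _ hk.1]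

lemma FR_apply {l : List (Fin n)} {k : Fin n} (hk : k ∉ l) (x : Fin n → ℤ) :
    FR C l x k = x k := by
  induction l with
  | nil => rfl
  | cons a t ih =>
    simp only [List.mem_cons, not_or] at hk
    simp only [FR, List.foldr_cons] at *; rw [refl_ne _ hk.1, ih hk.2]

lemma FR_nonneg (hoff : ∀ i j, i ≠ j → C i j ≤ 0) {l : List (Fin n)} (hl : l.Nodup)
    {x : Fin n → ℤ} (hx : ∀ j, 0 ≤ x j) (h0 : ∀ a ∈ l, x a = 0) : ∀ j, 0 ≤ FR C l x j := by
  induction l with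
  | nil => exact hx
  | cons a t ih =>
    rw [List.nodup_cons] at hl
    have h1 := ih hl.2 fun b hb => h0 b (List.mem_cons_of_mem _ hb)
    have h2 : FR C t x a = 0 := by rw [FR_apply hl.1]; exact h0 a (List.mem_cons_self)
    intro j
    change 0 ≤ simpleRefl n C a (FR C t x) j
    by_cases hj : j = a
    · subst hj
      have : ∑ i, C j i * FR C t x i ≤ 0 := by
        refine Finset.sum_nonpos fun i _ => ?_
        by_cases hi : i = j
        · subst hi; rw [h2]; simp
        · exact mul_nonpos_of_nonpos_of_nonneg (hoff _ _ (Ne.symm hi)) (h1 i)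
      simp only [simpleRefl, if_true, h2]; linarith
    · rw [refl_ne _ hj]; exact h1 j

lemma FL_fix {l : List (Fin n)} (hl : l.Nodup) {y : Fin n → ℤ} (hy : FL C l y = y) :
    ∀ a ∈ l, hh C a y = 0 := by
  induction l with
  | nil => simp
  | cons a t ih =>
    rw [List.nodup_cons] at hl
    have h1 : FL C t (simpleRefl n C a y) = y := hy
    have h2 : simpleRefl n C a y a = y a := by
      rw [← FL_apply (C := C) hl.1 (simpleRefl n C a y), h1]
    have h3 : hh C a y = 0 := by
      simp only [simpleRefl, if_true] at h2; unfold hh; linarith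
    have h4 : simpleRefl n C a y = y := by rw [refl_eq, h3]; simp
    rw [h4] at h1
    intro b hb
    rcases List.mem_cons.1 hb with rfl | hb
    · exact h3
    · exact ih hl.2 h1 b hb

/-! roots -/

lemma root_ind {x : Fin n → ℤ} (hx : x ∈ rootSet n C) :
    ∃ i l, x = FL C l (simpleRoot n i) := by
  obtain ⟨f, ⟨l, rfl⟩, i, rfl⟩ := hx
  exact ⟨i, l, rfl⟩

lemma root_refl {x : Fin n → ℤ} (hx : x ∈ rootSet n C) (a : Fin n) :
    simpleRefl n C a x ∈ rootSet n C := by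
  obtain ⟨f, ⟨l, rfl⟩, i, rfl⟩ := hx
  exact ⟨_, ⟨l ++ [a], rfl⟩, i, by simp⟩

lemma root_simple (i : Fin n) : simpleRoot n i ∈ rootSet n C := ⟨_, ⟨[], rfl⟩, i, rfl⟩

lemma root_FL {x : Fin n → ℤ} (hx : x ∈ rootSet n C) (l : List (Fin n)) :
    FL C l x ∈ rootSet n C := by
  induction l generalizing x with
  | nil => exact hx
  | cons a t ih => exact ih (root_refl hx a)

lemma root_FR {x : Fin n → ℤ} (hx : x ∈ rootSet n C) (l : List (Fin n)) :
    FR C l x ∈ rootSet n C := by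
  induction l with
  | nil => exact hx
  | cons a t ih => exact root_refl ih a

lemma root_inv (hdiag : ∀ i, C i i = 2) (hsym : ∀ i j, c i * C i j = c j * C j i)
    {x : Fin n → ℤ} (hx : x ∈ rootSet n C) :
    ∃ k, BB C c x x = 2 * c k ∧ ∀ i, c k ∣ c i * x i := by
  obtain ⟨f, ⟨l, rfl⟩, k, rfl⟩ := hx
  refine ⟨k, ?_⟩
  have key : ∀ (l : List (Fin n)) (x : Fin n → ℤ),
      (BB C c x x = 2 * c k ∧ ∀ i, c k ∣ c i * x i) →
      (BB C c (FL C l x) (FL C l x) = 2 * c k ∧ ∀ i, c k ∣ c i * FL C l x i) := by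
    intro l
    induction l with
    | nil => exact fun x h => h
    | cons a t ih =>
      rintro x ⟨h1, h2⟩
      refine ih (simpleRefl n C a x) ⟨by rw [refl_BB hdiag hsym, h1], fun i => ?_⟩
      by_cases hi : i = a
      · subst hi
        simp only [simpleRefl, if_true, mul_sub, Finset.mul_sum]
        refine dvd_sub (h2 i) (Finset.dvd_sum fun j _ => ?_)
        rw [← mul_assoc, hsym i j, mul_right_comm]
        exact Dvd.dvd.mul_right (h2 j) _
      · rw [refl_ne _ hi]; exact h2 i
  refine key l _ ⟨by rw [BB_left, hh_simple, hdiag]; ring, fun i => ?_⟩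
  by_cases hi : i = k <;> simp [simpleRoot, hi]

lemma BB_eq (hdiag : ∀ i, C i i = 2) (hoff : ∀ i j, i ≠ j → C i j ≤ 0)
    (hsym : ∀ i j, c i * C i j = c j * C j i) (x : Fin n → ℤ) :
    BB C c x x = 2 * cartanQuadForm n C c x := by
  rw [BB_apply, cartanQuadForm]
  have e1 : ∀ i : Fin n, ∑ j, x i * (c i * C i j) * x j = 2 * (c i * x i ^ 2) +
      (∑ j, (if i < j then x i * (c i * C i j) * x j else 0) +
      ∑ j, (if j < i then x i * (c i * C i j) * x j else 0)) := by
    intro i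
    have : 2 * (c i * x i ^ 2) = ∑ j, if j = i then x i * (c i * C i j) * x j else 0 := by
      simp [hdiag]; ring
    rw [this, ← Finset.sum_add_distrib, ← Finset.sum_add_distrib]
    refine Finset.sum_congr rfl fun j _ => ?_
    rcases lt_trichotomy i j with h | h | h
    · simp [h, h.ne', h.not_gt]
    · simp [h]
    · simp [h, h.ne, h.not_gt]
  rw [Finset.sum_congr rfl fun i _ => e1 i, Finset.sum_add_distrib, Finset.sum_add_distrib,
    ← Finset.mul_sum]
  have e2 : ∑ i : Fin n, ∑ j, (if j < i then x i * (c i * C i j) * x j else 0) =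
      ∑ i : Fin n, ∑ j, (if i < j then x i * (c i * C i j) * x j else 0) := by
    rw [Finset.sum_comm]
    refine Finset.sum_congr rfl fun i _ => Finset.sum_congr rfl fun j _ => ?_
    rw [hsym j i]
    split_ifs <;> ring
  have e3 : ∑ p ∈ Finset.univ.filter (fun p : Fin n × Fin n => p.1 < p.2),
      c p.1 * |C p.1 p.2| * x p.1 * x p.2 =
      - ∑ i : Fin n, ∑ j, (if i < j then x i * (c i * C i j) * x j else 0) := by
    rw [Finset.sum_filter, ← Finset.univ_product_univ, Finset.sum_product, ← Finset.sum_neg_distrib]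
    refine Finset.sum_congr rfl fun i _ => ?_
    rw [← Finset.sum_neg_distrib]
    refine Finset.sum_congr rfl fun j _ => ?_
    dsimp only
    split_ifs with h
    · rw [abs_of_nonpos (hoff i j h.ne)]; ring
    · simp
  rw [e2, e3]; ring

lemma dvd_quad {d : ℤ} {x : Fin n → ℤ} (h : ∀ i, d ∣ c i * x i) : d ∣ cartanQuadForm n C c x := by
  unfold cartanQuadForm
  refine dvd_sub (Finset.dvd_sum fun i _ => ?_) (Finset.dvd_sum fun p _ => ?_)
  · rw [pow_two, ← mul_assoc]; exact Dvd.dvd.mul_right (h i) _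
  · rw [mul_right_comm (c p.1)]
    exact Dvd.dvd.mul_right (Dvd.dvd.mul_right (h _) _) _

section main
variable (hdiag : ∀ i, C i i = 2) (hoff : ∀ i j, i ≠ j → C i j ≤ 0)
    (hc : ∀ i, 0 < c i)
    (hsym : ∀ i j, c i * C i j = c j * C j i)
    (hposdef : ∀ x : Fin n → ℤ, x ≠ 0 → 0 < cartanQuadForm n C c x)
include hdiag hoff hc hsym hposdef

lemma root_ne_zero {x : Fin n → ℤ} (hx : x ∈ rootSet n C) : x ≠ 0 := by
  obtain ⟨k, h1, -⟩ := root_inv hdiag hsym hx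
  rintro rfl
  have := hc k
  simp at h1
  omega

lemma pos_or_neg {x : Fin n → ℤ} (hx : x ∈ rootSet n C) :
    (∀ i, 0 ≤ x i) ∨ (∀ i, x i ≤ 0) := by
  obtain ⟨k, h1, h2⟩ := root_inv hdiag hsym hx
  by_contra hcon
  push Not at hcon
  obtain ⟨⟨a, ha⟩, ⟨b, hb⟩⟩ := hcon
  set u : Fin n → ℤ := fun i => max (x i) 0 with hu
  set v : Fin n → ℤ := fun i => max (-x i) 0 with hv
  have huv : x = u - v := by
    funext i
    simp only [hu, hv, Pi.sub_apply]
    rcases le_total (x i) 0 with h | h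
    · rw [max_eq_right h, max_eq_left (by linarith)]; ring
    · rw [max_eq_left h, max_eq_right (by linarith)]; ring
  have hu0 : u ≠ 0 := by
    intro h
    have := congrFun h b
    simp only [hu, Pi.zero_apply] at this
    rw [max_eq_left hb.le] at this; omega
  have hv0 : v ≠ 0 := by
    intro h
    have := congrFun h a
    simp only [hv, Pi.zero_apply] at this
    rw [max_eq_left (by linarith)] at this; omega
  have du : c k ∣ cartanQuadForm n C c u := by
    refine dvd_quad fun i => ?_
    simp only [hu]
    rcases max_choice (x i) 0 with h | h <;> rw [h]
    · exact h2 i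
    · simp
  have dv : c k ∣ cartanQuadForm n C c v := by
    refine dvd_quad fun i => ?_
    simp only [hv]
    rcases max_choice (-x i) 0 with h | h <;> rw [h]
    · rw [mul_neg]; exact (dvd_neg.2 (h2 i))
    · simp
  have lu := Int.le_of_dvd (hposdef u hu0) du
  have lv := Int.le_of_dvd (hposdef v hv0) dv
  have huvB : BB C c u v ≤ 0 := by
    rw [BB_apply]
    refine Finset.sum_nonpos fun i _ => Finset.sum_nonpos fun j _ => ?_
    by_cases hij : i = j
    · subst hij
      have : u i * v i = 0 := by
        simp only [hu, hv]
        rcases le_total (x i) 0 with h | h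
        · rw [max_eq_right h]; ring
        · rw [max_eq_right (a := -x i) (by linarith)]; ring
      rw [mul_right_comm, this]; simp
    · have h3 : 0 ≤ u i := le_max_right _ _
      have h4 : 0 ≤ v j := le_max_right _ _
      have h5 : c i * C i j ≤ 0 := mul_nonpos_of_nonneg_of_nonpos (hc i).le (hoff i j hij)
      exact mul_nonpos_of_nonpos_of_nonneg (mul_nonpos_of_nonneg_of_nonpos h3 h5) h4
  have e : BB C c x x = BB C c u u + BB C c v v - 2 * BB C c u v := by
    rw [huv]
    simp only [map_sub, LinearMap.sub_apply]
    rw [BB_symm hsym v u]; ring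
  rw [BB_eq hdiag hoff hsym u, BB_eq hdiag hoff hsym v, h1] at e
  have := hc k
  linarith

lemma pos_refl {x : Fin n → ℤ} (hx : x ∈ rootSet n C) (hpos : ∀ i, 0 ≤ x i) (a : Fin n)
    (hn : ¬ ∀ i, 0 ≤ simpleRefl n C a x i) : x = simpleRoot n a := by
  have h1 := (pos_or_neg hdiag hoff hc hsym hposdef (root_refl hx a)).resolve_left hn
  have h2 : x = x a • simpleRoot n a := by
    funext j
    by_cases hj : j = a
    · subst hj; simp [simpleRoot]
    · have := h1 j
      rw [refl_ne _ hj] at this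
      have := hpos j
      simp [simpleRoot, hj]; omega
  have h3 : x a = 1 := by
    obtain ⟨f, ⟨l, rfl⟩, k, hk⟩ := hx
    have h4 : FR C l x = simpleRoot n k := by rw [hk]; exact FR_FL hdiag l _
    rw [h2, FR_smul] at h4
    have h5 := congrFun h4 k
    simp only [simpleRoot, if_true, Pi.smul_apply, smul_eq_mul] at h5
    have h6 : x a ∣ 1 := ⟨_, h5.symm⟩
    exact Int.eq_one_of_dvd_one (hpos a) h6
  rw [h2, h3, one_smul]

lemma exists_split (l : List (Fin n)) {x : Fin n → ℤ} (hx : x ∈ rootSet n C)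
    (hpos : ∀ i, 0 ≤ x i) (hn : ¬ ∀ i, 0 ≤ FL C l x i) :
    ∃ l1 k l2, l = l1 ++ k :: l2 ∧ FL C l1 x = simpleRoot n k := by
  induction l generalizing x with
  | nil => exact absurd hpos hn
  | cons a t ih =>
    by_cases h : ∀ i, 0 ≤ simpleRefl n C a x i
    · obtain ⟨l1, k, l2, e, h3⟩ := ih (root_refl hx a) h hn
      exact ⟨a :: l1, k, l2, by rw [e]; rfl, h3⟩
    · exact ⟨[], a, t, rfl, pos_refl hdiag hoff hc hsym hposdef hx hpos a h⟩

lemma BB_nonneg (x : Fin n → ℤ) : 0 ≤ BB C c x x := by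
  by_cases h : x = 0
  · simp [h]
  · rw [BB_eq hdiag hoff hsym]; have := hposdef x h; linarith

lemma hh_inj {x : Fin n → ℤ} (h : ∀ i, hh C i x = 0) : x = 0 := by
  by_contra hx
  have h1 := hposdef x hx
  have h2 := BB_eq hdiag hoff hsym x
  have h3 : BB C c x x = 0 := by
    rw [BB_apply]
    refine Finset.sum_eq_zero fun i _ => ?_
    have : ∑ j, x i * (c i * C i j) * x j = x i * c i * hh C i x := by
      rw [hh, Finset.mul_sum]; exact Finset.sum_congr rfl fun j _ => by ring
    rw [this, h i, mul_zero]
  omega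

lemma roots_finite : (rootSet n C).Finite := by
  have hb : ∀ x ∈ rootSet n C, ∀ i, |hh C i x| ≤ ∑ k, 4 * c k := by
    intro x hx i
    obtain ⟨k, h1, -⟩ := root_inv hdiag hsym hx
    have h2 := BB_nonneg hdiag hoff hc hsym hposdef
      ((2 : ℤ) • x - hh C i x • simpleRoot n i)
    simp only [map_sub, map_smul, LinearMap.sub_apply, LinearMap.smul_apply, smul_eq_mul] at h2
    rw [BB_symm hsym x (simpleRoot n i), BB_left, BB_left, hh_simple, hdiag, h1] at h2
    have hck : 4 * c k ≤ ∑ k, 4 * c k :=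
      Finset.single_le_sum (f := fun k => 4 * c k) (fun k _ => by have := hc k; positivity)
        (Finset.mem_univ k)
    have hi := hc i
    have h3 : c i * hh C i x ^ 2 ≤ 4 * c k := by nlinarith
    have h4 : hh C i x ^ 2 ≤ 4 * c k := by nlinarith [sq_nonneg (hh C i x)]
    have h5 : |hh C i x| ≤ hh C i x ^ 2 := by
      rw [← sq_abs]; exact Int.le_self_sq _
    linarith
  refine Set.Finite.of_finite_image (f := fun x i => hh C i x) ?_ ?_
  · refine (Set.finite_Icc (fun _ : Fin n => -∑ k, 4 * c k) (fun _ => ∑ k, 4 * c k)).subset ?_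
    rintro _ ⟨x, hx, rfl⟩
    exact ⟨fun i => (abs_le.1 (hb x hx i)).1, fun i => (abs_le.1 (hb x hx i)).2⟩
  · intro x _ y _ hxy
    refine sub_eq_zero.1 (hh_inj hdiag hoff hc hsym hposdef fun i => ?_)
    rw [hh_sub]; exact sub_eq_zero.2 (congrFun hxy i)

lemma exists_neg {x : Fin n → ℤ} (hx : x ∈ rootSet n C) :
    ∃ m, ¬ ∀ i, 0 ≤ (FL C (List.finRange n))^[m] x i := by
  by_contra! hcon
  set T := FL C (List.finRange n) with hT
  have hr : ∀ m, T^[m] x ∈ rootSet n C := by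
    intro m
    induction m with
    | zero => exact hx
    | succ m ih => rw [Function.iterate_succ_apply']; exact root_FL ih _
  have : ∃ a b, a < b ∧ T^[a] x = T^[b] x := by
    have hf := roots_finite hdiag hoff hc hsym hposdef
    obtain ⟨a, -, b, -, hab, e⟩ := Set.infinite_univ.exists_lt_map_eq_of_mapsTo
      (f := fun m : ℕ => T^[m] x) (fun m _ => hr m) hf
    exact ⟨a, b, hab, e⟩
  obtain ⟨a, b, hab, e⟩ := this
  have hadd : ∀ x y, T (x + y) = T x + T y := FL_add _
  have h0 : T 0 = 0 := by simpa using FL_smul (C := C) (List.finRange n) 0 0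
  let L : (Fin n → ℤ) →+ (Fin n → ℤ) := ⟨⟨T, h0⟩, hadd⟩
  have hsum : T (∑ m ∈ Finset.Ico a b, T^[m] x) = ∑ m ∈ Finset.Ico a b, T^[m] x := by
    have h1 : T (∑ m ∈ Finset.Ico a b, T^[m] x) = ∑ m ∈ Finset.Ico a b, T^[m+1] x := by
      refine (map_sum L _ _).trans (Finset.sum_congr rfl fun m _ => ?_)
      rw [Function.iterate_succ_apply']; rfl
    have h2 := Finset.sum_Ico_sub (fun m => T^[m] x) hab.le
    rw [e, sub_self, Finset.sum_sub_distrib, sub_eq_zero] at h2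
    rw [h1, h2]
  have hz := hh_inj hdiag hoff hc hsym hposdef
    fun i => FL_fix (List.nodup_finRange n) hsum i (List.mem_finRange i)
  refine root_ne_zero hdiag hoff hc hsym hposdef (hr a) ?_
  funext i
  have hzi := congrFun hz i
  rw [Finset.sum_apply, Pi.zero_apply, Finset.sum_eq_zero_iff_of_nonneg
    (fun m _ => hcon m i)] at hzi
  exact hzi a (by simp [hab])

end main

lemma finRange_split (k : Fin n) :
    List.finRange n = (List.finRange n).take k ++ k :: (List.finRange n).drop (k + 1) := by
  have h : (k : ℕ) < (List.finRange n).length := by simp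
  conv_lhs => rw [← List.take_append_drop (k : ℕ) (List.finRange n), List.drop_eq_getElem_cons h]
  simp

lemma mem_take {k j : Fin n} (h : j ∈ (List.finRange n).take k) : j < k := by
  rw [List.mem_take_iff_getElem] at h
  obtain ⟨i, hi, rfl⟩ := h
  simp only [List.getElem_finRange, Fin.lt_def]
  simp at hi ⊢
  omega

lemma beta_self (k : Fin n) : betaRoot n C k k = 1 := by
  have : k ∉ (List.finRange n).take k := fun h => lt_irrefl _ (mem_take h)
  exact (FR_apply this _).trans (by simp [simpleRoot])

lemma beta_gt {k j : Fin n} (h : k < j) : betaRoot n C k j = 0 := by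
  have : j ∉ (List.finRange n).take k := fun h' => lt_asymm h (mem_take h')
  exact (FR_apply this _).trans (by simp [simpleRoot, h.ne'])

lemma beta_nonneg (hoff : ∀ i j, i ≠ j → C i j ≤ 0) (k : Fin n) : ∀ j, 0 ≤ betaRoot n C k j := by
  refine FR_nonneg hoff ((List.nodup_finRange n).sublist (List.take_sublist _ _)) ?_ ?_
  · intro j; unfold simpleRoot; split_ifs <;> simp
  · intro a ha; simp [simpleRoot, (mem_take ha).ne]

lemma beta_inj {k k' : Fin n} (h : betaRoot n C k = betaRoot n C k') : k = k' := by
  rcases lt_trichotomy k k' with h' | h' | h'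
  · have := beta_gt (C := C) h'
    rw [h, beta_self] at this; simp at this
  · exact h'
  · have := beta_gt (C := C) h'
    rw [← h, beta_self] at this; simp at this

lemma cox_beta (hdiag : ∀ i, C i i = 2) (k : Fin n) :
    FL C (List.finRange n) (betaRoot n C k) k = -1 := by
  have hnd := List.nodup_finRange n
  rw [finRange_split k, List.nodup_append, List.nodup_cons] at hnd
  rw [finRange_split k]
  have h1 : FL C ((List.finRange n).take k) (betaRoot n C k) = simpleRoot n k := FL_FR hdiag _ _
  simp only [FL, List.foldl_append, List.foldl_cons] at *
  rw [h1]
  refine (FL_apply hnd.2.1.1 _).trans ?_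
  rw [refl_eq, hh_simple, hdiag]
  simp [simpleRoot]

lemma distinct_aux (hdiag : ∀ i, C i i = 2) (hoff : ∀ i j, i ≠ j → C i j ≤ 0) (p : Fin n → ℕ)
    (hpmin : ∀ i r, 1 ≤ r → r < p i → ∀ l, 0 ≤ (coxeterMinus n C)^[r] (betaRoot n C i) l)
    (i i' : Fin n) (r r' : ℕ) (hr' : r' < p i') (hle : r ≤ r')
    (h : (coxeterMinus n C)^[r] (betaRoot n C i) = (coxeterMinus n C)^[r'] (betaRoot n C i')) :
    i = i' ∧ r = r' := by
  have hleft : Function.LeftInverse (FL C (List.finRange n)) (coxeterMinus n C) := FL_FR hdiag _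
  obtain ⟨d, rfl⟩ := Nat.exists_eq_add_of_le hle
  rw [Function.iterate_add_apply] at h
  have h2 := hleft.injective.iterate r h
  rcases d with _ | d
  · exact ⟨beta_inj h2, rfl⟩
  · exfalso
    have h3 := cox_beta hdiag i
    rw [h2, Function.iterate_succ_apply', hleft] at h3
    have : ∀ l, 0 ≤ (coxeterMinus n C)^[d] (betaRoot n C i') l := by
      rcases Nat.eq_zero_or_pos d with rfl | hd
      · exact beta_nonneg hoff i'
      · exact hpmin i' d hd (by omega)
    have := this i
    omega

end CoxAux

open CoxAux in
/-- Let `C` be a symmetrizable Cartan matrix of Dynkin type (positive definite `q_C`), with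
Coxeter transformation `c` and `βₖ = s₁⋯s_{k−1}(αₖ)`.  For each `i` let `pᵢ ≥ 1` be minimal
with `c^{−pᵢ}(βᵢ) ∉ ℕⁿ`.  Then the vectors `c^{−r}(βᵢ)`, `1 ≤ i ≤ n`, `0 ≤ r ≤ pᵢ−1`, are
pairwise distinct, and their set is exactly the set `Δ⁺(C)` of positive roots. -/
theorem positive_roots_via_coxeter_orbits (n : ℕ)
    (C : Matrix (Fin n) (Fin n) ℤ) (c : Fin n → ℤ)
    (hdiag : ∀ i, C i i = 2)
    (hoff : ∀ i j, i ≠ j → C i j ≤ 0)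
    (hzero : ∀ i j, C i j = 0 ↔ C j i = 0)
    (hc : ∀ i, 0 < c i)
    (hsym : ∀ i j, c i * C i j = c j * C j i)
    (hposdef : ∀ x : Fin n → ℤ, x ≠ 0 → 0 < cartanQuadForm n C c x)
    (p : Fin n → ℕ)
    (hp1 : ∀ i, 1 ≤ p i)
    (hpnot : ∀ i, ¬ (∀ l, 0 ≤ (coxeterMinus n C)^[p i] (betaRoot n C i) l))
    (hpmin : ∀ i r, 1 ≤ r → r < p i → ∀ l, 0 ≤ (coxeterMinus n C)^[r] (betaRoot n C i) l) :
    (∀ (i i' : Fin n) (r r' : ℕ), r < p i → r' < p i' →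
        (coxeterMinus n C)^[r] (betaRoot n C i) = (coxeterMinus n C)^[r'] (betaRoot n C i') →
        i = i' ∧ r = r') ∧
    {y | ∃ (i : Fin n) (r : ℕ), r < p i ∧ y = (coxeterMinus n C)^[r] (betaRoot n C i)} =
      rootSet n C ∩ {y | ∀ l, 0 ≤ y l} := by
  refine ⟨fun i i' r r' hr hr' h => ?_, ?_⟩
  · rcases le_total r r' with hle | hle
    · exact distinct_aux hdiag hoff p hpmin i i' r r' hr' hle h
    · obtain ⟨h1, h2⟩ := distinct_aux hdiag hoff p hpmin i' i r' r hr hle h.symm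
      exact ⟨h1.symm, h2.symm⟩
  · ext y
    constructor
    · rintro ⟨i, r, hr, rfl⟩
      constructor
      · clear hr
        induction r with
        | zero => exact root_FR (root_simple i) _
        | succ r ih => rw [Function.iterate_succ_apply']; exact root_FR ih _
      · rcases Nat.eq_zero_or_pos r with rfl | h
        · exact beta_nonneg hoff i
        · exact hpmin i r h hr
    · rintro ⟨hy, hpos⟩
      have hpos : ∀ l, 0 ≤ y l := hpos
      have hex := exists_neg hdiag hoff hc hsym hposdef hy
      classical
      obtain ⟨m, hm, hmin⟩ : ∃ m, (¬ ∀ i, 0 ≤ (FL C (List.finRange n))^[m] y i) ∧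
          ∀ k < m, ∀ i, 0 ≤ (FL C (List.finRange n))^[k] y i :=
        ⟨Nat.find hex, Nat.find_spec hex, fun k hk => not_not.1 (Nat.find_min hex hk)⟩
      rcases m with _ | m
      · exact absurd hpos hm
      have hroot : ∀ m, (FL C (List.finRange n))^[m] y ∈ rootSet n C := by
        intro m
        induction m with
        | zero => exact hy
        | succ m ih => rw [Function.iterate_succ_apply']; exact root_FL ih _
      rw [Function.iterate_succ_apply'] at hm
      obtain ⟨l1, k, l2, e, hk⟩ := exists_split hdiag hoff hc hsym hposdef _ (hroot m)
        (hmin m (Nat.lt_succ_self m)) hm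
      have hlen : l1.length = (k : ℕ) := by
        have h1 : (List.finRange n)[l1.length]? = some k := by rw [e]; simp
        obtain ⟨h2, h3⟩ := List.getElem?_eq_some_iff.1 h1
        rw [← h3]; simp
      have hl1 : (List.finRange n).take k = l1 := by rw [e, ← hlen]; simp
      have hb : betaRoot n C k = (FL C (List.finRange n))^[m] y := by
        change FR C ((List.finRange n).take k) (simpleRoot n k) = _
        rw [hl1, ← hk, FR_FL hdiag]
      have hleft : Function.LeftInverse (coxeterMinus n C) (FL C (List.finRange n)) :=
        FR_FL hdiag _
      have hit : ∀ r ≤ m, (coxeterMinus n C)^[r] (betaRoot n C k) =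
          (FL C (List.finRange n))^[m - r] y := by
        intro r hr
        obtain ⟨d, rfl⟩ := Nat.exists_eq_add_of_le hr
        rw [hb, Function.iterate_add_apply, hleft.iterate r, Nat.add_sub_cancel_left]
      refine ⟨k, m, ?_, ?_⟩
      · by_contra hlt
        push Not at hlt
        apply hpnot k
        rw [hit _ hlt]
        exact hmin _ (by omega)
      · rw [hit m le_rfl]; simp
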